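/- Let D be a strongly connected digraph on n ≥ 4 vertices which is not a directed cycle of length n. Suppose that min{d⁺(x) + d⁻(y), d⁻(x) + d⁺(y)} ≥ n for every pair of non-adjacent vertices x, y that have a common in-neighbour or a common out-neighbour. Then either D contains a cycle of length n − 1, or n is even and D is isomorphic to the complete bipartite digraph K*_{n/2,n/2}. -/

import Mathlib

/-!
Digraphs are modelled as a finite vertex type `V` together with an arc relation
`A : V → V → Prop` (irreflexive, i.e. no loops; no multiple arcs by construction).
-/

namespace PaperDG

variable {V : Type*}

/-- Out-degree of `v`: the number of out-neighbours. -/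
noncomputable def outDeg (A : V → V → Prop) (v : V) : ℕ := Nat.card {w : V // A v w}

/-- In-degree of `v`: the number of in-neighbours. -/
noncomputable def inDeg (A : V → V → Prop) (v : V) : ℕ := Nat.card {w : V // A w v}

/-- Degree `d(v) = d⁺(v) + d⁻(v)`. -/
noncomputable def deg (A : V → V → Prop) (v : V) : ℕ := outDeg A v + inDeg A v

/-- Strong connectivity: every vertex reaches every other by a directed path. -/
def IsStrong (A : V → V → Prop) : Prop := ∀ x y : V, Relation.ReflTransGen A x y

/-- The digraph has a directed cycle through `k` distinct vertices. -/
def HasCycle (A : V → V → Prop) (k : ℕ) : Prop :=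
  ∃ f : ZMod k → V, Function.Injective f ∧ ∀ i : ZMod k, A (f i) (f (i + 1))

/-- Condition (*): `d(x) + d(y) ≥ 2n - 1` and `min {d(x), d(y)} ≥ n - 1` for every pair of
non-adjacent vertices `x, y` with a common in-neighbour. -/
def CondStar [Fintype V] (A : V → V → Prop) : Prop :=
  ∀ x y : V, x ≠ y → ¬A x y → ¬A y x → (∃ u : V, A u x ∧ A u y) →
    2 * Fintype.card V - 1 ≤ deg A x + deg A y ∧
      Fintype.card V - 1 ≤ min (deg A x) (deg A y)

/-- Condition (**): `min {d⁺(x) + d⁻(y), d⁻(x) + d⁺(y)} ≥ n` for every pair of non-adjacent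
vertices `x, y` with a common in-neighbour or a common out-neighbour. -/
def CondStarStar [Fintype V] (A : V → V → Prop) : Prop :=
  ∀ x y : V, x ≠ y → ¬A x y → ¬A y x →
    ((∃ u : V, A u x ∧ A u y) ∨ (∃ u : V, A x u ∧ A y u)) →
    Fintype.card V ≤ min (outDeg A x + inDeg A y) (inDeg A x + outDeg A y)

/-- The digraph is (isomorphic to) the complete bipartite digraph `K*_{n/2,n/2}`:
there is a part `S` of size `n/2` such that the arcs are exactly the pairs of vertices
lying in different parts. -/
def IsKhalf [Fintype V] (A : V → V → Prop) : Prop :=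
  ∃ S : Set V, 2 * Nat.card S = Fintype.card V ∧
    ∀ x y : V, A x y ↔ (x ∈ S ↔ y ∉ S)

/-- The digraph is (isomorphic to) `K*_{n/2,n/2}` minus one arc. -/
def IsKhalfMinusArc [Fintype V] (A : V → V → Prop) : Prop :=
  ∃ S : Set V, ∃ a b : V, 2 * Nat.card S = Fintype.card V ∧ (a ∈ S ↔ b ∉ S) ∧
    ∀ x y : V, A x y ↔ ((x ∈ S ↔ y ∉ S) ∧ ¬(x = a ∧ y = b))

/-- Minimum semi-degree at least `k`. -/
def MinSemiDegreeGE (A : V → V → Prop) (k : ℕ) : Prop :=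
  ∀ v : V, k ≤ outDeg A v ∧ k ≤ inDeg A v

/-- Locally semicomplete: for every vertex `x` the out-neighbourhood and the
in-neighbourhood of `x` both induce semicomplete digraphs. -/
def LocallySemicomplete (A : V → V → Prop) : Prop :=
  ∀ x u v : V, u ≠ v →
    ((A x u → A x v → A u v ∨ A v u) ∧ (A u x → A v x → A u v ∨ A v u))

end PaperDG

open PaperDG

/-- The digraph is exactly a directed cycle through all n vertices. -/
def IsDirectedNCycle {V : Type*} [Fintype V] (A : V → V → Prop) : Prop :=
  ∃ f : ZMod (Fintype.card V) → V, Function.Bijective f ∧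
    ∀ a b : V, A a b ↔ ∃ i : ZMod (Fintype.card V), a = f i ∧ b = f (i + 1)


namespace DK
open Classical

variable {V : Type*} (A : V → V → Prop)

def Lk (l₁ l₂ : List V) : Prop := ∀ x ∈ l₁.getLast?, ∀ y ∈ l₂.head?, A x y

def Cyc (l : List V) : Prop := l ≠ [] ∧ l.Nodup ∧ l.IsChain A ∧ Lk A l l

noncomputable def cin (v : V) (l : List V) : ℕ := l.countP (fun p => decide (A p v))
noncomputable def cout (v : V) (l : List V) : ℕ := l.countP (fun p => decide (A v p))

def Ins (v w : V) (L : List V) : Prop :=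
  ∃ s t, s ≠ [] ∧ t ≠ [] ∧ L = s ++ t ∧ Lk A s [v] ∧ Lk A [w] t

variable {A}

theorem Lk_app_left {l₁ l₂ l₃ : List V} (h : l₂ ≠ []) : Lk A (l₁ ++ l₂) l₃ ↔ Lk A l₂ l₃ := by
  unfold Lk; rw [List.getLast?_append_of_ne_nil _ h]

theorem Lk_app_right {l₁ l₂ l₃ : List V} (h : l₁ ≠ []) : Lk A l₃ (l₁ ++ l₂) ↔ Lk A l₃ l₁ := by
  unfold Lk; rw [List.head?_append_of_ne_nil _ h]

theorem Lk_cons_left {a : V} {l₂ l₃ : List V} (h : l₂ ≠ []) : Lk A (a :: l₂) l₃ ↔ Lk A l₂ l₃ :=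
  Lk_app_left (l₁ := [a]) h

theorem Lk_cons_right {a : V} {l l₃ : List V} : Lk A l₃ (a :: l) ↔ Lk A l₃ [a] := by
  unfold Lk; simp

theorem Lk_single {a b : V} : Lk A [a] [b] ↔ A a b := by simp [Lk]

theorem last_ex {l : List V} (h : l ≠ []) : ∃ x ∈ l, ∀ l', Lk A l l' ↔ Lk A [x] l' := by
  refine ⟨l.getLast h, List.getLast_mem h, fun l' => ?_⟩
  conv_lhs => rw [← List.dropLast_append_getLast h]
  exact Lk_app_left (by simp)

theorem head_ex {l : List V} (h : l ≠ []) : ∃ x ∈ l, ∀ l', Lk A l' l ↔ Lk A l' [x] := by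
  cases l with
  | nil => exact absurd rfl h
  | cons a t => exact ⟨a, by simp, fun l' => Lk_cons_right⟩

theorem ch_app {l₁ l₂ : List V} : (l₁ ++ l₂).IsChain A ↔ l₁.IsChain A ∧ l₂.IsChain A ∧ Lk A l₁ l₂ :=
  List.isChain_append

theorem cyc_rot {l₁ l₂ : List V} (h : Cyc A (l₁ ++ l₂)) : Cyc A (l₂ ++ l₁) := by
  obtain ⟨h1, h2, h3, h4⟩ := h
  by_cases e1 : l₁ = []
  · subst e1; simpa [Cyc] using ⟨by simpa using h1, by simpa using h2, by simpa using h3, by simpa using h4⟩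
  by_cases e2 : l₂ = []
  · subst e2; simpa [Cyc] using ⟨by simpa using h1, by simpa using h2, by simpa using h3, by simpa using h4⟩
  rw [ch_app] at h3
  rw [Lk_app_left e2, Lk_app_right e1] at h4
  refine ⟨by simp [e1], (List.perm_append_comm.nodup_iff).1 h2, ?_, ?_⟩
  · rw [ch_app]; exact ⟨h3.2.1, h3.1, h4⟩
  · rw [Lk_app_left e1, Lk_app_right e2]; exact h3.2.2

theorem cyc_isRot {l l' : List V} (h : Cyc A l) (r : l.IsRotated l') : Cyc A l' := by
  obtain ⟨k, rfl⟩ := r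
  obtain hk | hk := le_total k l.length
  · rw [List.rotate_eq_drop_append_take hk]
    apply cyc_rot; rwa [List.take_append_drop]
  · rw [← List.rotate_mod, List.rotate_eq_drop_append_take (Nat.mod_lt _ (List.length_pos_iff.2 h.1)).le]
    apply cyc_rot; rwa [List.take_append_drop]

theorem rot_mem {l : List V} {v : V} (h : v ∈ l) : ∃ t, l.IsRotated (v :: t) := by
  obtain ⟨s, t, rfl⟩ := List.append_of_mem h
  exact ⟨t ++ s, by simpa using List.isRotated_append (l := s) (l' := v :: t)⟩

/-- counting lemmas -/
theorem cnt_aux {v w : V} : ∀ (a : V) (t : List V), ¬ Ins A v w (a :: t) →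
    cin A v (a :: t) + cout A w t ≤ t.length + 1 := by
  intro a t
  induction t generalizing a with
  | nil => intro _; simp [cin, cout, List.countP_cons]; split_ifs <;> simp
  | cons b t ih =>
    intro h
    have h1 : ¬ Ins A v w (b :: t) := by
      rintro ⟨s, t', hs, ht, e, h1, h2⟩
      exact h ⟨a :: s, t', by simp, ht, by simp [e], (Lk_cons_left hs).2 h1, h2⟩
    have h2 := ih b h1
    have h3 : ¬ (A a v ∧ A w b) := fun h3 => h ⟨[a], b :: t, by simp, by simp, by simp,
      Lk_single.2 h3.1, Lk_cons_right.2 (Lk_single.2 h3.2)⟩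
    simp only [cin, cout, List.countP_cons, List.length_cons, decide_eq_true_eq] at *
    split_ifs at * <;> simp_all <;> omega

theorem cnt_le {v w : V} {L : List V} (h : ¬ Ins A v w L) :
    cin A v L + cout A w L ≤ L.length + 1 := by
  cases L with
  | nil => simp [cin, cout]
  | cons a t =>
    have := cnt_aux a t h
    have h2 : cout A w (a :: t) ≤ cout A w t + 1 := by
      simp only [cout, List.countP_cons]; split_ifs <;> omega
    simp only [List.length_cons]; omega

theorem cnt_lt {v w : V} {L : List V} (h : ¬ Ins A v w L) (hL : L ≠ []) (h1 : ¬ Lk A L [v])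
    (h2 : ¬ Lk A [w] L) : cin A v L + cout A w L + 1 ≤ L.length := by
  obtain ⟨L', z, rfl⟩ : ∃ L' z, L = L' ++ [z] := ⟨_, _, (List.dropLast_append_getLast hL).symm⟩
  rw [Lk_app_left (by simp), Lk_single] at h1
  cases L' with
  | nil =>
    simp only [List.nil_append, Lk_single] at *
    simp [cin, cout, h1, h2]
  | cons a t =>
    rw [List.cons_append, Lk_cons_right, Lk_single] at h2
    have h3 : ∀ (a : V) (t : List V), ¬ Ins A v w (a :: t ++ [z]) →
       cin A v (a :: t) + cout A w (t ++ [z]) ≤ t.length + 1 := by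
      intro a t
      induction t generalizing a with
      | nil =>
        intro h
        have h3 : ¬ (A a v ∧ A w z) := fun h3 => h ⟨[a], [z], by simp, by simp, by simp,
          Lk_single.2 h3.1, (Lk_single.2 h3.2)⟩
        simp only [cin, cout, List.countP_cons, List.nil_append, List.countP_nil, decide_eq_true_eq]
        split_ifs <;> simp_all
      | cons b t ih =>
        intro h
        have h1 : ¬ Ins A v w (b :: t ++ [z]) := by
          rintro ⟨s, t', hs, ht, e, h1, h2⟩
          exact h ⟨a :: s, t', by simp, ht, by simpa using e, (Lk_cons_left hs).2 h1, h2⟩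
        have h2 := ih b h1
        have h3 : ¬ (A a v ∧ A w b) := fun h3 => h ⟨[a], b :: t ++ [z], by simp, by simp, by simp,
          Lk_single.2 h3.1, Lk_cons_right.2 (Lk_single.2 h3.2)⟩
        simp only [cin, cout, List.countP_cons, List.cons_append, List.length_cons, decide_eq_true_eq] at *
        split_ifs at * <;> simp_all <;> omega
    have h4 := h3 a t h
    have e1 : cin A v (a :: t ++ [z]) = cin A v (a :: t) := by
      simp [cin, h1, List.countP_cons]
    have e2 : cout A w (a :: t ++ [z]) = cout A w (t ++ [z]) := by
      simp [cout, h2, List.countP_cons]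
    rw [e1, e2]; simp; omega

theorem last_split {P : V → Prop} : ∀ {Q : List V}, (∃ a ∈ Q, P a) →
    ∃ s a t, Q = s ++ a :: t ∧ P a ∧ ∀ b ∈ t, ¬ P b := by
  intro Q
  induction Q with
  | nil => simp
  | cons q Q ih =>
    intro h
    by_cases h1 : ∃ a ∈ Q, P a
    · obtain ⟨s, a, t, e, h2, h3⟩ := ih h1
      exact ⟨q :: s, a, t, by simp [e], h2, h3⟩
    · push Not at h1
      obtain ⟨a, ha, hp⟩ := h
      rcases List.mem_cons.1 ha with rfl | ha
      · exact ⟨[], a, Q, rfl, hp, h1⟩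
      · exact absurd hp (h1 a ha)

theorem multi_ins : ∀ (N : ℕ) (Q L : List V), Q.length ≤ N → L.IsChain A → Q.IsChain A →
    (∀ q ∈ Q, Ins A q q L) →
    ∃ L' : List V, L'.Perm (L ++ Q) ∧ L'.IsChain A ∧ L'.head? = L.head? ∧ L'.getLast? = L.getLast? := by
  intro N
  induction N with
  | zero =>
    intro Q L h hL hQ _
    have : Q = [] := by simpa using h
    subst this
    exact ⟨L, by simp, hL, rfl, rfl⟩
  | succ N ih =>
    intro Q L h hL hQ hI
    cases Q with
    | nil => exact ⟨L, by simp, hL, rfl, rfl⟩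
    | cons q Q =>
    obtain ⟨s, t, hs, ht, rfl, h1, h2⟩ := hI q (by simp)
    obtain ⟨s', a, t', e, ha, hb⟩ := last_split (P := fun z => Lk A [z] t) (Q := q :: Q) ⟨q, by simp, h2⟩
    have e' : q :: Q = (s' ++ [a]) ++ t' := by simp [e]
    have hne : s' ++ [a] ≠ [] := by simp
    have hhd : Lk A s (s' ++ [a]) := by
      have : Lk A s (q :: Q) := Lk_cons_right.2 h1
      rw [e', Lk_app_right hne] at this; exact this
    rw [e', ch_app] at hQ
    rw [ch_app] at hL
    obtain ⟨L', hp, hc, hh, hl⟩ := ih t' (s ++ (s' ++ [a]) ++ t) (by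
      have := congrArg List.length e'; simp at this h; omega) (by
      rw [ch_app, ch_app, Lk_app_left hne]
      exact ⟨⟨hL.1, hQ.1, hhd⟩, hL.2.1, (Lk_app_left (by simp)).2 ha⟩) hQ.2.1 (by
      intro z hz
      have hzt := hb z hz
      obtain ⟨s2, t2, hs2, ht2, e2, h3, h4⟩ := hI z (by rw [e']; simp [hz])
      rw [List.append_eq_append_iff] at e2
      rcases e2 with ⟨w, rfl, rfl⟩ | ⟨w, rfl, rfl⟩
      · by_cases hw : w = []
        · subst hw; simp at hzt; exact absurd h4 hzt
        · refine ⟨s ++ (s' ++ [a]) ++ w, t2, by simp, ht2, by simp, ?_, h4⟩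
          rw [Lk_app_left hw] at h3 ⊢; exact h3
      · by_cases hw : w = []
        · subst hw; simp at h4; exact absurd h4 hzt
        · refine ⟨s2, w ++ (s' ++ [a]) ++ t, hs2, by simp, by simp, h3, ?_⟩
          rw [Lk_app_right hw] at h4
          rw [List.append_assoc, Lk_app_right hw]; exact h4)
    refine ⟨L', hp.trans ?_, hc, ?_, ?_⟩
    · rw [e']
      have : (s ++ (s' ++ [a]) ++ t).Perm (s ++ t ++ (s' ++ [a])) := by
        rw [List.append_assoc s, List.append_assoc s]
        exact List.Perm.append_left _ List.perm_append_comm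
      have := this.append_right t'
      simpa using this
    · rw [hh, List.append_assoc, List.head?_append_of_ne_nil _ hs, List.head?_append_of_ne_nil _ hs]
    · rw [hl, List.getLast?_append_of_ne_nil _ ht, List.getLast?_append_of_ne_nil _ ht]

theorem Lk_congr_left {l l' m : List V} (h : l.getLast? = l'.getLast?) : Lk A l m ↔ Lk A l' m := by
  unfold Lk; rw [h]
theorem Lk_congr_right {l l' m : List V} (h : l.head? = l'.head?) : Lk A m l ↔ Lk A m l' := by
  unfold Lk; rw [h]

theorem exists_min {α : Type*} (P : α → Prop) (f : α → ℕ) (h : ∃ x, P x) :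
    ∃ x, P x ∧ ∀ y, P y → f x ≤ f y := by
  have h' : ∃ k, ∃ x, P x ∧ f x = k := by obtain ⟨x, hx⟩ := h; exact ⟨_, x, hx, rfl⟩
  obtain ⟨x, hx, e⟩ := Nat.find_spec h'
  exact ⟨x, hx, fun y hy => e ▸ Nat.find_min' h' ⟨y, hy, rfl⟩⟩


/-! second part -/

def Full (l : List V) : Prop := l.Nodup ∧ ∀ v, v ∈ l

theorem cin_app {v : V} {l l' : List V} : cin A v (l ++ l') = cin A v l + cin A v l' := by
  simp [cin]
theorem cout_app {v : V} {l l' : List V} : cout A v (l ++ l') = cout A v l + cout A v l' := by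
  simp [cout]
theorem cin_le {v : V} {l : List V} : cin A v l ≤ l.length := List.countP_le_length
theorem cout_le {v : V} {l : List V} : cout A v l ≤ l.length := List.countP_le_length
theorem cin_zero {v : V} {l : List V} (h : ∀ z ∈ l, ¬ A z v) : cin A v l = 0 := by
  simpa [cin, List.countP_eq_zero] using h
theorem cout_zero {v : V} {l : List V} (h : ∀ z ∈ l, ¬ A v z) : cout A v l = 0 := by
  simpa [cout, List.countP_eq_zero] using h
theorem cin_cons {v a : V} {l : List V} : cin A v (a :: l) = cin A v l + if A a v then 1 else 0 := by
  simp [cin, List.countP_cons]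
theorem cout_cons {v a : V} {l : List V} : cout A v (a :: l) = cout A v l + if A v a then 1 else 0 := by
  simp [cout, List.countP_cons]
theorem cin_nil {v : V} : cin A v [] = 0 := rfl
theorem cout_nil {v : V} : cout A v [] = 0 := rfl
theorem cin_perm {v : V} {l l' : List V} (h : l.Perm l') : cin A v l = cin A v l' := h.countP_eq _
theorem cout_perm {v : V} {l l' : List V} (h : l.Perm l') : cout A v l = cout A v l' := h.countP_eq _

theorem cin_self {v : V} {l : List V} (hirr : ∀ v, ¬ A v v) (h : v ∈ l) : cin A v l + 1 ≤ l.length := by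
  obtain ⟨s, t, rfl⟩ := List.append_of_mem h
  have h1 := cin_le (A := A) (v := v) (l := s)
  have h2 := cin_le (A := A) (v := v) (l := t)
  rw [cin_app, cin_cons, if_neg (hirr v)]; simp; omega
theorem cout_self {v : V} {l : List V} (hirr : ∀ v, ¬ A v v) (h : v ∈ l) : cout A v l + 1 ≤ l.length := by
  obtain ⟨s, t, rfl⟩ := List.append_of_mem h
  have h1 := cout_le (A := A) (v := v) (l := s)
  have h2 := cout_le (A := A) (v := v) (l := t)
  rw [cout_app, cout_cons, if_neg (hirr v)]; simp; omega

theorem cc {y a : V} : ∀ {R : List V}, (∀ u ∈ R, ¬ (A y u ∧ A u a)) → cout A y R + cin A a R ≤ R.length := by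
  intro R
  induction R with
  | nil => simp [cin, cout]
  | cons u R ih =>
    intro h
    have h1 := ih (fun z hz => h z (by simp [hz]))
    have h2 := h u (by simp)
    rw [cin_cons, cout_cons, List.length_cons]
    split_ifs <;> simp_all <;> omega

theorem cin_full {a : V} : ∀ {R : List V}, R.length ≤ cin A a R → ∀ z ∈ R, A z a := by
  intro R h
  have : cin A a R = R.length := le_antisymm cin_le h
  simpa [cin, List.countP_eq_length] using this

theorem outDeg_eq [Fintype V] {l : List V} (h : Full l) (v : V) : outDeg A v = cout A v l := by
  have e : (Finset.univ : Finset V) = l.toFinset := by ext z; simp [h.2 z]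
  rw [outDeg, Nat.card_eq_fintype_card, Fintype.card_subtype, e, cout, List.countP_eq_length_filter,
    ← List.toFinset_card_of_nodup (h.1.filter _), List.toFinset_filter]
  simp
theorem inDeg_eq [Fintype V] {l : List V} (h : Full l) (v : V) : inDeg A v = cin A v l := by
  have e : (Finset.univ : Finset V) = l.toFinset := by ext z; simp [h.2 z]
  rw [inDeg, Nat.card_eq_fintype_card, Fintype.card_subtype, e, cin, List.countP_eq_length_filter,
    ← List.toFinset_card_of_nodup (h.1.filter _), List.toFinset_filter]
  simp
theorem full_card [Fintype V] {l : List V} (h : Full l) : Fintype.card V = l.length := by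
  have e : (Finset.univ : Finset V) = l.toFinset := by ext z; simp [h.2 z]
  rw [← Finset.card_univ, e, List.toFinset_card_of_nodup h.1]

theorem dense [Fintype V] (hs : CondStarStar A) {l : List V} (hl : Full l) {x y : V} (hxy : x ≠ y) (h1 : ¬ A x y)
    (h2 : ¬ A y x) (h3 : (∃ u, A u x ∧ A u y) ∨ (∃ u, A x u ∧ A y u)) :
    l.length ≤ cout A x l + cin A y l ∧ l.length ≤ cin A x l + cout A y l := by
  have := hs x y hxy h1 h2 h3
  rwa [full_card hl, outDeg_eq hl, outDeg_eq hl, inDeg_eq hl, inDeg_eq hl, le_min_iff] at this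

theorem nodup_iff' {l : List V} : l.Nodup ↔ ∀ x, l.count x ≤ 1 := List.nodup_iff_count_le_one

def Byp (A : V → V → Prop) (C1 C2 : List V) (v : V) : Prop :=
  C1 ≠ [] ∧ Cyc A (C1 ++ C2) ∧ v ∉ C1 ++ C2 ∧ Lk A C1 [v] ∧ Lk A [v] C1

theorem shrink {C1 C2 : List V} {v z : V} (h : Byp A C1 C2 v) (hz : z ∈ C2) (hv : A z v ∨ A v z) :
    ∃ C1' C2', Byp A C1' C2' v ∧ (C1 ++ C2).IsRotated (C1' ++ C2') ∧ C2'.length < C2.length := by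
  obtain ⟨h1, h2, h3, h4, h5⟩ := h
  obtain ⟨s, t, rfl⟩ := List.append_of_mem hz
  rcases hv with hv | hv
  · have e : C1 ++ (s ++ z :: t) = (C1 ++ s ++ [z]) ++ t := by simp
    refine ⟨C1 ++ s ++ [z], t, ⟨by simp, e ▸ h2, e ▸ h3, ?_, ?_⟩, by rw [e], by simp; omega⟩
    · rw [Lk_app_left (by simp)]; exact Lk_single.2 hv
    · rw [List.append_assoc, Lk_app_right h1]; exact h5
  · have r : (C1 ++ (s ++ z :: t)).IsRotated ((z :: t ++ C1) ++ s) := by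
      have := List.isRotated_append (l := C1 ++ s) (l' := z :: t)
      simpa using this
    refine ⟨z :: t ++ C1, s, ⟨by simp, cyc_isRot h2 r, fun hh => h3 (r.mem_iff.2 hh), ?_, ?_⟩, r, by simp⟩
    · rw [Lk_app_left h1]; exact h4
    · exact Lk_cons_right.2 (Lk_single.2 hv)

theorem byp_ex {C : List V} {v p q : V} (hC : Cyc A C) (hv : v ∉ C) (hp : p ∈ C) (hq : q ∈ C)
    (h1 : A p v) (h2 : A v q) : ∃ C1 C2, Byp A C1 C2 v ∧ C.IsRotated (C1 ++ C2) := by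
  obtain ⟨t, r⟩ := rot_mem hq
  obtain ⟨s, t', e⟩ := List.append_of_mem (r.mem_iff.1 hp)
  have e' : q :: t = (s ++ [p]) ++ t' := by simp [e]
  refine ⟨s ++ [p], t', ⟨by simp, e' ▸ cyc_isRot hC r, fun hh => hv (r.mem_iff.2 (e' ▸ hh)), ?_, ?_⟩, e' ▸ r⟩
  · rw [Lk_app_left (by simp)]; exact Lk_single.2 h1
  · have : Lk A [v] (q :: t) := Lk_cons_right.2 (Lk_single.2 h2)
    rwa [e', Lk_app_right (by simp)] at this

theorem byp_na {C : List V} {v p q : V} (hC : Cyc A C) (hv : v ∉ C) (hp : p ∈ C) (hq : q ∈ C)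
    (h1 : A p v) (h2 : A v q) : ∃ C1 C2, Byp A C1 C2 v ∧ C.IsRotated (C1 ++ C2) ∧
      ∀ z ∈ C2, ¬ A z v ∧ ¬ A v z := by
  obtain ⟨C1, C2, h⟩ := byp_ex hC hv hp hq h1 h2
  obtain ⟨⟨D1, D2⟩, hD, hmin⟩ := exists_min (α := List V × List V)
    (fun D => Byp A D.1 D.2 v ∧ C.IsRotated (D.1 ++ D.2)) (fun D => D.2.length) ⟨(C1, C2), h⟩
  refine ⟨D1, D2, hD.1, hD.2, fun z hz => ?_⟩
  by_contra hcon
  obtain ⟨E1, E2, hE, hr, hl⟩ := shrink hD.1 hz (by tauto)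
  change E2.length < D2.length at hl
  have : D2.length ≤ E2.length := hmin (E1, E2) ⟨hE, hD.2.trans hr⟩
  omega

/-- block insertion: if a path `B` (from `b₁` to `b₂`) can be placed in `C1` -/
theorem ins_block {C1 D : List V} (B : List V) {a b : V} (hI : Ins A a b C1) (hch : C1.IsChain A)
    (hB : B.IsChain A) (hBne : B ≠ []) (hD : D.IsChain A) (hDne : D ≠ [])
    (h1 : ∀ l, Lk A l [a] → Lk A l B) (h2 : ∀ l, Lk A [b] l → Lk A B l)
    (hCD : Lk A C1 D) (hDC : Lk A D C1) (hnd : (C1 ++ D ++ B).Nodup) :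
    ∃ l, Cyc A l ∧ l.length = (C1 ++ D ++ B).length := by
  obtain ⟨s, t, hs, ht, rfl, h3, h4⟩ := hI
  rw [ch_app] at hch
  rw [Lk_app_left ht] at hCD
  rw [Lk_app_right hs] at hDC
  refine ⟨s ++ (B ++ (t ++ D)), ⟨by simp [hs], ?_, ?_, ?_⟩, by simp; omega⟩
  · rw [nodup_iff'] at *
    intro x; have := hnd x; simp only [List.count_append] at *; omega
  · rw [ch_app, ch_app, ch_app, Lk_app_right ht, Lk_app_right hBne]
    exact ⟨hch.1, ⟨hB, ⟨hch.2.1, hD, hCD⟩, h2 _ h4⟩, h1 _ h3⟩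
  · rw [Lk_app_right hs, ← List.append_assoc, ← List.append_assoc, Lk_app_left hDne]; exact hDC

theorem byp_notins {C1 C2 : List V} {v : V} (h : Byp A C1 C2 v)
    (hno : ∀ l, Cyc A l → l.length ≠ (C1 ++ C2).length + 1) : ¬ Ins A v v C1 ∧ C2 ≠ [] := by
  obtain ⟨h1, h2, h3, h4, h5⟩ := h
  have hne : C2 ≠ [] := by
    rintro rfl
    simp only [List.append_nil] at *
    refine hno (C1 ++ [v]) ⟨by simp, ?_, ?_, ?_⟩ (by simp)
    · exact List.nodup_append.2 ⟨h2.2.1, by simp, by simp; rintro a ha rfl; exact h3 ha⟩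
    · rw [ch_app]; exact ⟨h2.2.2.1, by simp, h4⟩
    · rw [Lk_app_left (by simp), Lk_app_right h1]; exact h5
  refine ⟨fun hI => ?_, hne⟩
  obtain ⟨c1, c2, c3, c4⟩ := h2
  rw [ch_app] at c3
  rw [Lk_app_left hne, Lk_app_right h1] at c4
  obtain ⟨l, hl, e⟩ := ins_block [v] hI c3.1 (by simp) (by simp) c3.2.1 hne (fun _ h => h) (fun _ h => h)
    c3.2.2 c4 (List.nodup_append.2 ⟨c2, by simp, by simp; rintro a ha rfl; exact h3 (by simpa using ha)⟩)
  exact hno l hl (by rw [e]; simp; omega)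

theorem step1 [Fintype V] (hirr : ∀ v, ¬ A v v) (hs : CondStarStar A) {C1 C2 R t t' : List V} {y a b : V}
    (hB : Byp A C1 C2 y) (hF : Full (C1 ++ C2 ++ y :: R))
    (hna : ∀ z ∈ C2, ¬ A z y ∧ ¬ A y z)
    (hno : ∀ l, Cyc A l → l.length ≠ (C1 ++ C2).length + 1)
    (ha : C2 = a :: t) (hb : C2 = t' ++ [b]) :
    cin A y C1 + cout A y C1 ≤ C1.length + 1 ∧ cin A a C2 + 1 ≤ C2.length ∧
    2 * R.length + 2 + (C1.length + 1) + C2.length ≤ (cout A y R + cin A a R) + (cin A y R + cout A b R)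
      + (cin A y C1 + cout A y C1) + (cin A a C2 + 1) := by
  obtain ⟨hni, hne⟩ := byp_notins hB hno
  obtain ⟨h1, h2, h3, h4, h5⟩ := hB
  have haC : a ∈ C2 := by simp [ha]
  have hbC : b ∈ C2 := by simp [hb]
  obtain ⟨c1, c2, c3, c4⟩ := h2
  rw [ch_app] at c3
  rw [Lk_app_left hne, Lk_app_right h1] at c4
  have hya : y ≠ a := by rintro rfl; exact h3 (by simp [haC])
  have hyb : y ≠ b := by rintro rfl; exact h3 (by simp [hbC])
  have d1 := (dense hs hF hya (hna a haC).2 (hna a haC).1 (by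
    obtain ⟨x, hx, hx2⟩ := last_ex (A := A) h1
    refine Or.inl ⟨x, Lk_single.1 ((hx2 _).1 h4), ?_⟩
    have := (hx2 _).1 c3.2.2
    rw [ha, Lk_cons_right, Lk_single] at this; exact this)).1
  have d2 := (dense hs hF hyb (hna b hbC).2 (hna b hbC).1 (by
    obtain ⟨x, hx, hx2⟩ := head_ex (A := A) h1
    refine Or.inr ⟨x, Lk_single.1 ((hx2 _).1 h5), ?_⟩
    have := (hx2 _).1 c4
    rw [hb, Lk_app_left (by simp), Lk_single] at this; exact this)).2
  have hni2 : ¬ Ins A a b C1 := by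
    intro hI
    obtain ⟨l, hl, e⟩ := ins_block (D := [y]) C2 hI c3.1 c3.2.1 hne (by simp) (by simp)
      (fun l hl => by rw [ha, Lk_cons_right]; exact hl)
      (fun l hl => by rw [hb, Lk_app_left (by simp)]; exact hl) h4 h5 (by
        have := hF.1
        rw [nodup_iff'] at *
        intro x; have := this x; simp only [List.count_append, List.count_cons, List.count_nil] at *; omega)
    exact hno l hl (by rw [e]; simp; omega)
  have e1 := cnt_le hni
  have e2 := cnt_le hni2
  have e3 := cin_self hirr haC
  have e4 := cout_self hirr hbC
  have z1 : cin A y C2 = 0 := cin_zero fun z hz => (hna z hz).1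
  have z2 : cout A y C2 = 0 := cout_zero fun z hz => (hna z hz).2
  refine ⟨e1, e3, ?_⟩
  simp only [cin_app, cout_app, cin_cons, cout_cons, if_neg (hirr y), if_neg (hna a haC).2,
    if_neg (hna b hbC).1, List.length_append,
    List.length_cons] at d1 d2
  omega

theorem step1r2 [Fintype V] (hirr : ∀ v, ¬ A v v) (hs : CondStarStar A) {C1 C2 t t' : List V} {y u a b : V}
    (hB : Byp A C1 C2 y) (hF : Full (C1 ++ C2 ++ [y, u]))
    (hna : ∀ z ∈ C2, ¬ A z y ∧ ¬ A y z)
    (hno : ∀ l, Cyc A l → l.length ≠ (C1 ++ C2).length + 1)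
    (ha : C2 = a :: t) (hb : C2 = t' ++ [b]) :
    A y u ∧ A u a ∧ A u y ∧ A b u ∧ cin A y C1 + cout A y C1 = C1.length + 1 ∧
      ∀ z ∈ C2, z ≠ a → A z a := by
  obtain ⟨h1, h2, h3⟩ := step1 hirr hs hB hF hna hno ha hb
  simp only [cin_cons, cout_cons, cin_nil, cout_nil, List.length_cons, List.length_nil] at h3
  have k1 : A y u := by by_contra h; rw [if_neg h] at h3; split_ifs at h3 <;> omega
  have k2 : A u a := by by_contra h; rw [if_neg h] at h3; split_ifs at h3 <;> omega
  have k3 : A u y := by by_contra h; rw [if_neg h] at h3; split_ifs at h3 <;> omega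
  have k4 : A b u := by by_contra h; rw [if_neg h] at h3; split_ifs at h3 <;> omega
  rw [if_pos k1, if_pos k2, if_pos k3, if_pos k4] at h3
  refine ⟨k1, k2, k3, k4, by omega, fun z hz hza => ?_⟩
  have h4 : t.length ≤ cin A a t := by
    have e : cin A a C2 = cin A a t := by rw [ha, cin_cons, if_neg (hirr a)]; rfl
    have e2 : C2.length = t.length + 1 := by simp [ha]
    rw [← e]; omega
  rw [ha, List.mem_cons] at hz
  exact cin_full h4 z (by tauto)

theorem mi_cyc {L Q pre : List V} (hL : L ≠ []) (hcL : L.IsChain A) (hcQ : Q.IsChain A)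
    (hI : ∀ q ∈ Q, Ins A q q L) (hp : pre.IsChain A) (hpne : pre ≠ []) (h1 : Lk A pre L) (h2 : Lk A L pre)
    (hnd : (pre ++ L ++ Q).Nodup) : ∃ l, Cyc A l ∧ l.length = (pre ++ L ++ Q).length := by
  obtain ⟨L', hpm, hc, hh, hl⟩ := multi_ins Q.length Q L le_rfl hcL hcQ hI
  have hne : L' ≠ [] := by
    rintro rfl; have := hpm.length_eq; simp at this; exact hL (List.length_eq_zero_iff.1 (by omega))
  refine ⟨pre ++ L', ⟨by simp [hpne], ?_, ?_, ?_⟩, ?_⟩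
  · rw [nodup_iff'] at *
    intro x; have := hnd x; have h := hpm.count_eq x; simp only [List.count_append] at *; omega
  · rw [ch_app]; exact ⟨hp, hc, (Lk_congr_right hh).2 h1⟩
  · rw [Lk_app_left hne, Lk_app_right hpne]; exact (Lk_congr_left hl).2 h2
  · have := hpm.length_eq; simp at this ⊢; omega

theorem big_gap [Fintype V] (hirr : ∀ v, ¬ A v v) (hs : CondStarStar A) {C1 C2 : List V} {y u : V}
    (hB : Byp A C1 C2 y) (hF : Full (C1 ++ C2 ++ [y, u]))
    (hmin : ∀ D1 D2 v, Byp A D1 D2 v → (D1 ++ D2).length = (C1 ++ C2).length → C2.length ≤ D2.length)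
    (hno : ∀ l, Cyc A l → l.length ≠ (C1 ++ C2).length + 1) (h2 : 2 ≤ C2.length) : False := by
  have hna : ∀ z ∈ C2, ¬ A z y ∧ ¬ A y z := by
    intro z hz
    by_contra hcon
    obtain ⟨E1, E2, hE, hr, hl⟩ := shrink hB hz (by tauto)
    have := hmin _ _ _ hE hr.perm.length_eq.symm
    omega
  obtain ⟨hni, hne⟩ := byp_notins hB hno
  obtain ⟨a, t, ha⟩ : ∃ a t, C2 = a :: t := List.exists_cons_of_ne_nil hne
  obtain ⟨t', b, hb⟩ : ∃ t' b, C2 = t' ++ [b] := ⟨_, _, (List.dropLast_append_getLast hne).symm⟩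
  obtain ⟨yu, ua, uy, bu, hcy, hza⟩ := step1r2 hirr hs hB hF hna hno ha hb
  have haC : a ∈ C2 := by simp [ha]
  have hbC : b ∈ C2 := by simp [hb]
  have hnd := hF.1
  have huC : u ∉ C1 ++ C2 := by
    intro h
    exact (List.nodup_append.1 hnd).2.2 u h u (by simp) rfl
  -- degree of u
  have hu : cin A u (C1 ++ C2) + cout A u (C1 ++ C2) ≤ C1.length + 1 := by
    obtain ⟨D1, D2, hD, hr, hDna⟩ := byp_na hB.2.1 huC (p := b) (q := a) (by simp [hbC]) (by simp [haC]) bu ua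
    have hle := hr.perm.length_eq
    obtain ⟨hni', _⟩ := byp_notins hD (by rw [← hle]; exact hno)
    have := cnt_le hni'
    have h3 := hmin _ _ _ hD hle.symm
    rw [cin_perm hr.perm, cout_perm hr.perm, cin_app, cout_app, cin_zero (fun z hz => (hDna z hz).1),
      cout_zero (fun z hz => (hDna z hz).2)]
    simp at hle; omega
  have key : ∀ x ∈ C2, ¬ (A u x ∧ A x u) → Ins A x x C1 := by
    intro x hx hxu
    by_contra hI
    have c1 := cnt_le hI
    have c2 := cin_self hirr hx
    have c3 := cout_self hirr hx
    have hxy : x ≠ y := by rintro rfl; exact hB.2.2.1 (by simp [hx])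
    have hxu' : x ≠ u := by rintro rfl; exact huC (by simp [hx])
    have z1 : cin A y C2 = 0 := cin_zero fun z hz => (hna z hz).1
    have z2 : cout A y C2 = 0 := cout_zero fun z hz => (hna z hz).2
    have n1 := (hna x hx).1
    have n2 := (hna x hx).2
    have fin : ∀ w, cin A x [y, u] + cout A x [y, u] + (cin A w (C1 ++ C2 ++ [y, u]) + cout A w (C1 ++ C2 ++ [y, u])) ≤ C1.length + 4 →
        (C1 ++ C2 ++ [y, u]).length ≤ cout A x (C1 ++ C2 ++ [y, u]) + cin A w (C1 ++ C2 ++ [y, u]) ∧ (C1 ++ C2 ++ [y, u]).length ≤ cin A x (C1 ++ C2 ++ [y, u]) + cout A w (C1 ++ C2 ++ [y, u]) → False := by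
      intro w h1 h2
      rw [cin_app (v := x), cout_app (v := x), cin_app (v := x), cout_app (v := x)] at h2
      simp only [List.length_append, List.length_cons, List.length_nil] at h2
      omega
    by_cases hadj : A u x ∨ A x u
    · refine fin y ?_ (dense hs hF hxy n1 n2 ?_)
      · rw [cin_app (v := y), cout_app (v := y), cin_app (v := y), cout_app (v := y), z1, z2]
        simp only [cin_cons, cout_cons, if_neg n1, if_neg n2, if_neg (hirr y)]
        have : (if A u x then 1 else 0) + (if A x u then 1 else 0) ≤ 1 := by
          split_ifs <;> simp_all
        simp only [cin, cout, List.countP_nil] at *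
        split_ifs at * <;> omega
      · rcases hadj with h | h
        · exact Or.inl ⟨u, h, uy⟩
        · exact Or.inr ⟨u, h, yu⟩
    · push Not at hadj
      refine fin u ?_ (dense hs hF hxu' hadj.2 hadj.1 (Or.inr ⟨a, hza x hx ?_, ua⟩))
      · rw [cin_app (v := u), cout_app (v := u)]
        simp only [cin_cons, cout_cons, if_neg n1, if_neg n2, if_neg hadj.1, if_neg hadj.2, if_neg (hirr u)]
        simp only [cin, cout, List.countP_nil] at *
        split_ifs at * <;> omega
      · rintro rfl; exact hadj.1 ua
  obtain ⟨h1, hcyc, h3, h4, h5⟩ := hB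
  obtain ⟨c1, c2, c3, c4⟩ := hcyc
  rw [ch_app] at c3
  rw [Lk_app_left hne, Lk_app_right h1] at c4
  by_cases hex : ∃ x ∈ C2, A u x ∧ A x u
  · obtain ⟨x, hx, ux, xu⟩ := hex
    obtain ⟨s, w, e⟩ := List.append_of_mem hx
    have hcyc : Cyc A (C1 ++ C2) := ⟨c1, c2, by rw [ch_app]; exact c3, by rw [Lk_app_left hne, Lk_app_right h1]; exact c4⟩
    -- uniqueness
    have uniq : ∀ z ∈ s ++ w, ¬ (A u z ∧ A z u) := by
      rintro z hz ⟨uz, zu⟩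
      have main : ∀ s0 p w1 q w2, A p u → A u q → C2 = s0 ++ p :: (w1 ++ q :: w2) → False := by
        intro s0 p w1 q w2 hp hq e
        have r : (C1 ++ C2).IsRotated ((q :: w2 ++ C1 ++ s0 ++ [p]) ++ w1) := by
          rw [e]
          have := List.isRotated_append (l := C1 ++ s0 ++ p :: w1) (l' := q :: w2)
          simpa using this
        have := hmin (q :: w2 ++ C1 ++ s0 ++ [p]) w1 u ⟨by simp, cyc_isRot hcyc r, fun hh => huC (r.mem_iff.2 hh),
          by rw [Lk_app_left (by simp)]; exact Lk_single.2 hp, Lk_cons_right.2 (Lk_single.2 hq)⟩ r.perm.length_eq.symm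
        rw [e] at this; simp at this; omega
      rcases List.mem_append.1 hz with hz | hz
      · obtain ⟨s0, w1, rfl⟩ := List.append_of_mem hz
        exact main s0 z w1 x w zu ux (by simp [e])
      · obtain ⟨w1, w2, rfl⟩ := List.append_of_mem hz
        exact main s x w1 z w2 xu uz e
    have hch2 := c3.2.1
    have e' : C2 = (s ++ [x]) ++ w := by simp [e]
    by_cases hw : w = []
    · subst hw
      have hsne : s ≠ [] := by rintro rfl; rw [e] at h2; simp at h2
      obtain ⟨a', s', rfl⟩ := List.exists_cons_of_ne_nil hsne
      obtain ⟨l, hl, hlen⟩ := mi_cyc (Q := s') (pre := [y, u, x]) h1 c3.1 (by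
          have e2 : C2 = [a'] ++ (s' ++ [x]) := by simp [e]
          rw [e2, ch_app, ch_app] at hch2; exact hch2.2.1.1) (fun q hq => key q (by rw [e]; simp [hq]) (uniq q (by simp [hq])))
        (by simp [yu, ux]) (by simp) (by
          rw [e', List.append_nil, Lk_app_left (by simp)] at c4
          rw [Lk_cons_left (by simp), Lk_cons_left (by simp)]; exact c4) (Lk_cons_right.2 h4) (by
          rw [nodup_iff'] at *
          intro z; have := hnd z; rw [e] at this
          simp only [List.count_append, List.count_cons, List.count_nil] at *; omega)
      refine hno l hl ?_
      rw [hlen, e]; simp; omega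
    · obtain ⟨w', b', rfl⟩ : ∃ w' b', w = w' ++ [b'] := ⟨_, _, (List.dropLast_append_getLast hw).symm⟩
      obtain ⟨l, hl, hlen⟩ := mi_cyc (Q := w') (pre := s ++ [x] ++ [u, y]) h1 c3.1 (by
          have := hch2; rw [e', ch_app] at this; exact (ch_app.1 this.2.1).1) (fun q hq => key q (by rw [e]; simp [hq]) (uniq q (by simp [hq])))
        (by rw [e', ch_app] at hch2
            rw [ch_app, Lk_app_left (by simp)]; exact ⟨hch2.1, by simp [uy], Lk_cons_right.2 (Lk_single.2 xu)⟩) (by simp) (by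
          rw [Lk_app_left (by simp), Lk_cons_left (by simp)]; exact h5) (by
          have := c3.2.2
          rw [e', Lk_app_right (by simp)] at this
          rw [Lk_app_right (by simp)]; exact this) (by
          rw [nodup_iff'] at *
          intro z; have := hnd z; rw [e] at this
          simp only [List.count_append, List.count_cons, List.count_nil] at *; omega)
      refine hno l hl ?_
      rw [hlen, e]; simp; omega
  · push Not at hex
    obtain ⟨l, hl, e⟩ := mi_cyc (Q := C2) (pre := [y]) h1 c3.1 c3.2.1 (fun q hq => key q hq (by have := hex q hq; tauto))
      (by simp) (by simp) h5 h4 (by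
        rw [nodup_iff'] at *
        intro x; have := hnd x; simp only [List.count_append, List.count_cons, List.count_nil] at *; omega)
    exact hno l hl (by rw [e]; simp only [List.length_append, List.length_cons, List.length_nil]; omega)

/-! third part -/

def St (A : V → V → Prop) (T : List V) (z y u : V) : Prop :=
  Byp A T [z] y ∧ Full (T ++ [z] ++ [y, u])

theorem noins {L : List V} {x : V} {n : ℕ} (hno : ∀ l, Cyc A l → l.length ≠ n) (hL : Cyc A L) (hx : x ∉ L)
    (hlen : L.length + 1 = n) (h1 : Lk A L [x]) (h2 : Lk A [x] L) : False := by
  refine hno (L ++ [x]) ⟨by simp, ?_, ?_, ?_⟩ (by simpa using hlen)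
  · exact List.nodup_append.2 ⟨hL.2.1, by simp, by simp; rintro a ha rfl; exact hx ha⟩
  · rw [ch_app]; exact ⟨hL.2.2.1, by simp, h1⟩
  · rw [Lk_app_left (by simp), Lk_app_right hL.1]; exact h2

theorem Lk_hd {a b : V} {l : List V} : Lk A [a] (b :: l) ↔ A a b := by simp [Lk]

section G2
variable [Fintype V]

theorem st_len {T : List V} {z y u : V} (h : St A T z y u) : Fintype.card V = (T ++ [z]).length + 2 := by
  rw [full_card h.2]; simp

theorem st_u {T : List V} {z y u : V} (h : St A T z y u) : u ∉ T ++ [z] := fun hh =>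
  (List.nodup_append.1 h.2.1).2.2 u hh u (by simp) rfl

theorem st_na (hno : ∀ l, Cyc A l → l.length ≠ Fintype.card V - 1) {T : List V} {z y u : V} (h : St A T z y u) : ¬ A z y ∧ ¬ A y z := by
  by_contra hcon
  obtain ⟨E1, E2, hE, hr, hl⟩ := shrink (z := z) h.1 (by simp) (by tauto)
  have h1 := st_len h
  have h2 := hr.perm.length_eq
  refine (byp_notins hE ?_).2 (List.length_eq_zero_iff.1 (by simp at hl; simp [hl]))
  intro l hl' e
  exact hno l hl' (by omega)

theorem st_base (hirr : ∀ v, ¬ A v v) (hs : CondStarStar A) (hno : ∀ l, Cyc A l → l.length ≠ Fintype.card V - 1)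
    {T : List V} {z y u : V} (h : St A T z y u) : A y u ∧ A u z ∧ A u y ∧ A z u ∧
    cin A y (T ++ [z]) + cout A y (T ++ [z]) = (T ++ [z]).length := by
  have hn := st_na hno h
  have hl := st_len h
  obtain ⟨h1, h2, h3, h4, h5, -⟩ := step1r2 hirr hs h.1 h.2 (by simpa using hn)
    (fun l hl' e => hno l hl' (by omega)) (t := []) (t' := []) rfl rfl
  refine ⟨h1, h2, h3, h4, ?_⟩
  rw [cin_app, cout_app, cin_cons, cout_cons, if_neg hn.1, if_neg hn.2, cin_nil, cout_nil, List.length_append]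
  simp; omega

theorem st_one (hirr : ∀ v, ¬ A v v) (hs : CondStarStar A) (hno : ∀ l, Cyc A l → l.length ≠ Fintype.card V - 1)
    {T L : List V} {z y u : V} (h : St A T z y u) (hr : (T ++ [z]).IsRotated L) :
    (Lk A L [y] ↔ ¬ Lk A [y] L) := by
  have hl := st_len h
  have hL := cyc_isRot h.1.2.1 hr
  have hle := hr.perm.length_eq
  have hN : ∀ L', (T ++ [z]).IsRotated L' → ¬ (Lk A L' [y] ∧ Lk A [y] L') := by
    intro L' hr' hh
    have hle' := hr'.perm.length_eq
    exact noins hno (cyc_isRot h.1.2.1 hr') (fun hy => h.1.2.2.1 (hr'.mem_iff.2 hy)) (by omega) hh.1 hh.2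
  refine ⟨fun a b => hN L hr ⟨a, b⟩, fun b => ?_⟩
  by_contra a
  have := cnt_lt (v := y) (w := y) (L := L) (by
    rintro ⟨s, t, hs, ht, rfl, h1, h2⟩
    exact hN (t ++ s) (hr.trans List.isRotated_append) ⟨(Lk_app_left hs).2 h1, (Lk_app_right ht).2 h2⟩) hL.1 a b
  have hb := (st_base hirr hs hno h).2.2.2.2
  rw [cin_perm hr.perm, cout_perm hr.perm] at hb
  omega

theorem st_move (hirr : ∀ v, ¬ A v v) (hs : CondStarStar A) (hno : ∀ l, Cyc A l → l.length ≠ Fintype.card V - 1)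
    {T : List V} {z y u w : V} (h : St A T z y u) (hw : w ∈ T ++ [z]) (h1 : ¬ A w y) (h2 : ¬ A y w) :
    ∃ t, St A t w y u ∧ (T ++ [z]).IsRotated (t ++ [w]) := by
  obtain ⟨t, r⟩ := rot_mem hw
  have r' : (T ++ [z]).IsRotated (t ++ [w]) := r.trans (by simpa using List.isRotated_append (l := [w]) (l' := t))
  have ht : t ≠ [] := by
    rintro rfl
    have := r.perm.length_eq
    have h0 := List.length_pos_iff.2 h.1.1
    simp at this; exact h.1.1 this
  have o1 := st_one hirr hs hno h r
  have o2 := st_one hirr hs hno h r'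
  rw [Lk_cons_left ht, Lk_hd] at o1
  rw [Lk_app_left (by simp), Lk_single, Lk_app_right ht] at o2
  refine ⟨t, ⟨⟨ht, cyc_isRot h.1.2.1 r', fun hy => h.1.2.2.1 (r'.mem_iff.2 hy), o1.2 h2, by tauto⟩, ?_⟩, r'⟩
  have p := r'.perm.append_right [y, u]
  exact ⟨p.nodup_iff.1 h.2.1, fun v => p.mem_iff.1 (h.2.2 v)⟩

theorem st_swap {T : List V} {z y u : V} (h : St A T z y u) : St A T y z u := by
  obtain ⟨⟨h1, ⟨c1, c2, c3, c4⟩, h3, h4, h5⟩, hF⟩ := h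
  rw [ch_app] at c3
  rw [Lk_app_left (by simp), Lk_app_right h1] at c4
  have p : (T ++ [z] ++ [y, u]).Perm (T ++ [y] ++ [z, u]) := by
    simp only [List.append_assoc, List.cons_append, List.nil_append]
    exact List.Perm.append_left _ (List.Perm.swap _ _ _)
  have hF' := p.nodup_iff.1 hF.1
  refine ⟨⟨h1, ⟨by simp, (List.nodup_append.1 hF').1, ?_, ?_⟩, ?_, c3.2.2, c4⟩, hF', fun v => p.mem_iff.1 (hF.2 v)⟩
  · rw [ch_app]; exact ⟨c3.1, by simp, h4⟩
  · rw [Lk_app_left (by simp), Lk_app_right h1]; exact h5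
  · intro hh; exact (List.nodup_append.1 hF').2.2 z hh z (by simp) rfl

theorem around {C : List V} {P : V → Prop} (hP : ∀ w w' t, C.IsRotated (w :: w' :: t) → P w → P w')
    {w0 : V} (h0 : w0 ∈ C) (hw : P w0) : ∀ z ∈ C, P z := by
  have key : ∀ (t2 t1 : List V) (w : V), C.IsRotated (w :: t2 ++ t1) → P w → ∀ z ∈ w :: t2, P z := by
    intro t2
    induction t2 with
    | nil => intro t1 w _ hw z hz; simp at hz; rwa [hz]
    | cons w' t3 ih =>
      intro t1 w r hw z hz
      have hw' := hP w w' (t3 ++ t1) (by simpa using r) hw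
      rcases List.mem_cons.1 hz with rfl | hz
      · exact hw
      · refine ih (t1 ++ [w]) w' (r.trans ?_) hw' z hz
        simpa using List.isRotated_append (l := [w]) (l' := w' :: t3 ++ t1)
  obtain ⟨t, r⟩ := rot_mem h0
  intro z hz
  exact key t [] w0 (by simpa using r) hw z (r.mem_iff.1 hz)

theorem rot1 {C t : List V} {w : V} (r : C.IsRotated (w :: t)) : C.IsRotated (t ++ [w]) :=
  r.trans (by simpa using List.isRotated_append (l := [w]) (l' := t))

theorem rot2 {C : List V} {w : V} (h : w ∈ C) (h2 : 2 ≤ C.length) : ∃ w' t, C.IsRotated (w :: w' :: t) := by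
  obtain ⟨t, r⟩ := rot_mem h
  have := r.perm.length_eq
  cases t with
  | nil => simp at this; omega
  | cons w' t => exact ⟨w', t, r⟩

theorem rot2' {C : List V} {w : V} (h : w ∈ C) (h2 : 2 ≤ C.length) : ∃ p t, C.IsRotated (p :: w :: t) := by
  obtain ⟨t, r⟩ := rot_mem h
  have := r.perm.length_eq
  have ht : t ≠ [] := by rintro rfl; simp at this; omega
  obtain ⟨t', b, rfl⟩ : ∃ t' b, t = t' ++ [b] := ⟨_, _, (List.dropLast_append_getLast ht).symm⟩
  exact ⟨b, t', r.trans (by simpa using List.isRotated_append (l := w :: t') (l' := [b]))⟩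

theorem st_two {T : List V} {z y u : V} (h : St A T z y u) : 2 ≤ (T ++ [z]).length := by
  have h0 := List.length_pos_iff.2 h.1.1
  simp; omega

theorem st_alt (hirr : ∀ v, ¬ A v v) (hs : CondStarStar A) (hno : ∀ l, Cyc A l → l.length ≠ Fintype.card V - 1)
    {T t : List V} {z y u w w' : V} (h : St A T z y u) (hr : (T ++ [z]).IsRotated (w :: w' :: t)) :
    A w y ↔ ¬ A y w' := by
  have := st_one hirr hs hno h (rot1 hr)
  rwa [Lk_app_left (by simp), List.cons_append, Lk_hd, Lk_hd] at this

/-- neighbours of `u` cannot be consecutive -/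
theorem st_nu (hno : ∀ l, Cyc A l → l.length ≠ Fintype.card V - 1)
    {T t : List V} {z y u w w' : V} (h : St A T z y u) (hr : (T ++ [z]).IsRotated (w :: w' :: t)) :
    ¬ (A w u ∧ A u w') := by
  rintro ⟨h1, h2⟩
  have r := rot1 hr
  have hl := st_len h
  have := r.perm.length_eq
  refine noins hno (cyc_isRot h.1.2.1 r) (fun hu => st_u h (r.mem_iff.2 hu)) (by omega) ?_ ?_
  · rw [Lk_app_left (by simp)]; exact Lk_single.2 h1
  · rw [List.cons_append]; exact Lk_cons_right.2 (Lk_single.2 h2)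

theorem st_sym (hirr : ∀ v, ¬ A v v) (hs : CondStarStar A) (hno : ∀ l, Cyc A l → l.length ≠ Fintype.card V - 1)
    {T : List V} {z y u : V} (h : St A T z y u) : ∀ w ∈ T ++ [z],
      (A w y ∧ A y w) ∨ (¬ A w y ∧ ¬ A y w ∧ A w u ∧ A u w) := by
  have hE : ∀ w ∈ T ++ [z], ¬ A w y → ¬ A y w → A w u ∧ A u w := by
    intro w hw h1 h2
    obtain ⟨t, hst, -⟩ := st_move hirr hs hno h hw h1 h2
    have := st_base hirr hs hno hst
    tauto
  have hb := st_base hirr hs hno h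
  have hz := st_na hno h
  have hl := st_len h
  have hnd := h.2.1
  have hF : ∀ w ∈ T ++ [z], ¬ (A w y ∧ ¬ A y w) := by
    intro w hw hP
    have := around (C := T ++ [z]) (P := fun w => A w y ∧ ¬ A y w) (by
      rintro w w' t r ⟨h1, h2⟩
      have ha := st_alt hirr hs hno h r
      refine ⟨?_, ha.1 h1⟩
      by_contra h3
      have hu := hE w' (r.mem_iff.2 (by simp)) h3 (ha.1 h1)
      have ho := st_one hirr hs hno h r
      rw [Lk_hd, Lk_cons_left (by simp)] at ho
      have hc := cyc_isRot h.1.2.1 r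
      have hp := r.perm
      have hpl := hp.length_eq
      refine hno ((w' :: t) ++ [y, u]) ⟨by simp, ?_, ?_, ?_⟩ ?_
      · rw [nodup_iff'] at *
        intro x; have := hnd x; have hx := hp.count_eq x
        simp only [List.count_append, List.count_cons, List.count_nil] at *; omega
      · rw [ch_app]
        refine ⟨?_, by simp [hb.1], Lk_cons_right.2 (ho.2 h2)⟩
        have := hc.2.2.1
        exact (ch_app (l₁ := [w]).1 this).2.1
      · rw [Lk_app_left (by simp), Lk_cons_left (by simp), List.cons_append, Lk_cons_right]
        exact Lk_single.2 hu.2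
      · simp at hpl hl ⊢; omega) hw hP z (by simp)
    exact hz.1 this.1
  have hG : ∀ w ∈ T ++ [z], ¬ (A y w ∧ ¬ A w y) := by
    intro w hw hP
    refine around (C := T ++ [z]) (P := fun w => ¬ (A y w ∧ ¬ A w y)) ?_ (w0 := z) (by simp) (fun hh => hz.2 hh.1) w hw hP
    rintro w w' t r hn ⟨h1, h2⟩
    have ha := st_alt hirr hs hno h r
    have h3 : ¬ A w y := by tauto
    have h4 : ¬ A y w := by tauto
    have hu := hE w (r.mem_iff.2 (by simp)) h3 h4
    have r2 : (T ++ [z]).IsRotated (t ++ [w] ++ [w']) := rot1 (rot1 r)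
    have ho := st_one hirr hs hno h r2
    rw [Lk_app_left (by simp), Lk_single, Lk_app_right (by simp)] at ho
    have hc := cyc_isRot h.1.2.1 r2
    have hp := r2.perm
    have hpl := hp.length_eq
    refine hno ((t ++ [w]) ++ [u, y]) ⟨by simp, ?_, ?_, ?_⟩ ?_
    · rw [nodup_iff'] at *
      intro x; have := hnd x; have hx := hp.count_eq x
      simp only [List.count_append, List.count_cons, List.count_nil] at *; omega
    · rw [ch_app]
      refine ⟨?_, by simp [hb.2.2.1], ?_⟩
      · exact (ch_app.1 hc.2.2.1).1
      · rw [Lk_app_left (by simp), Lk_cons_right, Lk_single]; exact hu.1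
    · rw [Lk_app_left (by simp), Lk_cons_left (by simp), Lk_app_right (by simp)]
      tauto
    · simp at hpl hl ⊢; omega
  intro w hw
  have := hE w hw
  have := hF w hw
  have := hG w hw
  tauto

theorem st_indep (hirr : ∀ v, ¬ A v v) (hs : CondStarStar A) (hno : ∀ l, Cyc A l → l.length ≠ Fintype.card V - 1)
    {T : List V} {z y u x x' : V} (h : St A T z y u) (hx : x ∈ T ++ [z]) (hx' : x' ∈ T ++ [z])
    (h1 : ¬ A x y) (h2 : ¬ A x' y) : ¬ A x x' := by
  intro hxx
  have hne : x' ≠ x := by rintro rfl; exact hirr _ hxx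
  have s1 := st_sym hirr hs hno h x hx
  have s2 := st_sym hirr hs hno h x' hx'
  obtain ⟨t, hst, r⟩ := st_move hirr hs hno h hx h1 (by tauto)
  have hsw := st_swap hst
  have hm : x' ∈ t ++ [y] := by
    have := r.mem_iff.1 hx'
    simp at this ⊢; tauto
  have s3 := st_sym hirr hs hno hsw x' hm
  obtain ⟨w', t', r'⟩ := rot2 hm (st_two hsw)
  have ha := st_alt hirr hs hno hsw r'
  have s4 := st_sym hirr hs hno hsw w' (r'.mem_iff.2 (by simp))
  exact st_nu hno hsw r' (by tauto)

theorem st_compl (hirr : ∀ v, ¬ A v v) (hs : CondStarStar A) (hno : ∀ l, Cyc A l → l.length ≠ Fintype.card V - 1)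
    {T : List V} {z y u x w : V} (h : St A T z y u) (hx : x ∈ T ++ [z]) (hw : w ∈ T ++ [z])
    (h1 : ¬ A x y) (h2 : A w y) : A x w ∧ A w x := by
  have s1 := st_sym hirr hs hno h x hx
  have s2 := st_sym hirr hs hno h w hw
  obtain ⟨t, hst, r⟩ := st_move hirr hs hno h hx h1 (by tauto)
  have hsw := st_swap hst
  have hm : w ∈ t ++ [y] := by
    have hwx : w ≠ x := by rintro rfl; exact h1 h2
    have := r.mem_iff.1 hw
    simp at this ⊢; tauto
  have s3 := st_sym hirr hs hno hsw w hm
  obtain ⟨w', t', r'⟩ := rot2 hw (st_two h)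
  have ha := st_alt hirr hs hno h r'
  have s4 := st_sym hirr hs hno h w' (r'.mem_iff.2 (by simp))
  have := st_nu hno h r'
  tauto

theorem st_unu (hirr : ∀ v, ¬ A v v) (hs : CondStarStar A) (hno : ∀ l, Cyc A l → l.length ≠ Fintype.card V - 1)
    {T : List V} {z y u w : V} (h : St A T z y u) (hw : w ∈ T ++ [z])
    (h2 : A w y) : ¬ A u w ∧ ¬ A w u := by
  have s2 := st_sym hirr hs hno h w hw
  obtain ⟨w', t', r'⟩ := rot2 hw (st_two h)
  obtain ⟨p, t, r⟩ := rot2' hw (st_two h)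
  have a1 := st_alt hirr hs hno h r'
  have a2 := st_alt hirr hs hno h r
  have s4 := st_sym hirr hs hno h w' (r'.mem_iff.2 (by simp))
  have s5 := st_sym hirr hs hno h p (r.mem_iff.2 (by simp))
  have n1 := st_nu hno h r'
  have n2 := st_nu hno h r
  tauto

theorem st_o (hirr : ∀ v, ¬ A v v) (hs : CondStarStar A) (hno : ∀ l, Cyc A l → l.length ≠ Fintype.card V - 1)
    {T : List V} {z y u w : V} (h : St A T z y u) (hw : w ∈ T ++ [z])
    (h2 : A w y) : ∃ t, St A t w u y ∧ (T ++ [z]).IsRotated (t ++ [w]) := by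
  have s2 := st_sym hirr hs hno h w hw
  obtain ⟨t, r⟩ := rot_mem hw
  have r' := rot1 r
  have ht : t ≠ [] := by
    rintro rfl
    have h8 := r.perm.length_eq
    have h9 := st_two h
    rw [h8] at h9
    simp at h9
  have o1 := st_one hirr hs hno h r
  have o2 := st_one hirr hs hno h r'
  rw [Lk_cons_left ht, Lk_hd] at o1
  rw [Lk_app_left (by simp), Lk_single, Lk_app_right ht] at o2
  obtain ⟨a, ha, ha'⟩ := head_ex (A := A) ht
  obtain ⟨b, hb, hb'⟩ := last_ex (A := A) ht
  have sa := st_sym hirr hs hno h a (r.mem_iff.2 (by simp [ha]))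
  have sb := st_sym hirr hs hno h b (r.mem_iff.2 (by simp [hb]))
  have p : (T ++ [z] ++ [y, u]).Perm (t ++ [w] ++ [u, y]) :=
    r'.perm.append (List.Perm.swap _ _ _)
  rw [ha', Lk_single] at o2
  rw [hb', Lk_single] at o1
  refine ⟨t, ⟨⟨ht, cyc_isRot h.1.2.1 r', fun hy => st_u h (r'.mem_iff.2 hy), ?_, ?_⟩, p.nodup_iff.1 h.2.1, fun v => p.mem_iff.1 (h.2.2 v)⟩, r'⟩
  · rw [hb', Lk_single]; tauto
  · rw [ha', Lk_single]; tauto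

theorem st_char (hirr : ∀ v, ¬ A v v) (hs : CondStarStar A) (hno : ∀ l, Cyc A l → l.length ≠ Fintype.card V - 1)
    {T : List V} {z y u : V} (h : St A T z y u) (x x' : V) : A x x' ↔ (¬ A x y ↔ A x' y) := by
  have hb := st_base hirr hs hno h
  have iy := hirr y
  have iu := hirr u
  have mem : ∀ v, v ∈ T ++ [z] ∨ v = y ∨ v = u := by
    intro v; have := h.2.2 v; simp at this ⊢; tauto
  have s := st_sym hirr hs hno h
  have ind := fun x hx x' hx' => st_indep hirr hs hno h (x := x) (x' := x') hx hx'
  have com := fun x hx x' hx' => st_compl hirr hs hno h (x := x) (w := x') hx hx'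
  have unu := fun x hx => st_unu hirr hs hno h (w := x) hx
  have o : ∀ x ∈ T ++ [z], ∀ x' ∈ T ++ [z], A x y → A x' y → ¬ A x x' := by
    intro x hx x' hx' h1 h2
    obtain ⟨t, hst, r⟩ := st_o hirr hs hno h hx h1
    exact st_indep hirr hs hno hst (r.mem_iff.1 hx) (r.mem_iff.1 hx') (unu x hx h1).2 (unu x' hx' h2).2
  rcases mem x with hx | rfl | rfl <;> rcases mem x' with hx' | rfl | rfl
  · have := s x hx
    have := s x' hx'
    have := ind x hx x' hx'
    have := com x hx x' hx'
    have := com x' hx' x hx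
    have := o x hx x' hx'
    tauto
  · tauto
  · have := s x hx
    have := unu x hx
    tauto
  · have := s x' hx'
    tauto
  · tauto
  · tauto
  · have := s x' hx'
    have := unu x' hx'
    tauto
  · tauto
  · tauto

theorem st_final (hirr : ∀ v, ¬ A v v) (hs : CondStarStar A) (hno : ∀ l, Cyc A l → l.length ≠ Fintype.card V - 1)
    {T : List V} {z y u : V} (h : St A T z y u) : Even (Fintype.card V) ∧ IsKhalf A := by
  have ch := st_char hirr hs hno h
  have hb := st_base hirr hs hno h
  have hz := st_na hno h
  have iy := hirr y
  have hzy : y ≠ z := by rintro rfl; exact h.1.2.2.1 (by simp)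
  have e0 : Nat.card {v : V // A v y} + Nat.card {v : V // ¬ A v y} = Fintype.card V := by
    rw [Nat.card_eq_fintype_card, Nat.card_eq_fintype_card]
    have := Fintype.card_subtype_compl (fun v : V => A v y)
    have h2 := Fintype.card_subtype_le (fun v : V => A v y)
    omega
  have c1 : ∀ v, ¬ A v y → outDeg A v = Nat.card {v : V // A v y} ∧ inDeg A v = Nat.card {v : V // A v y} := by
    intro v hv
    constructor
    · exact Nat.card_congr (Equiv.subtypeEquivRight fun w => by rw [ch]; tauto)
    · exact Nat.card_congr (Equiv.subtypeEquivRight fun w => by rw [ch]; tauto)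
  have c2 : ∀ v, A v y → outDeg A v = Nat.card {v : V // ¬ A v y} ∧ inDeg A v = Nat.card {v : V // ¬ A v y} := by
    intro v hv
    constructor
    · exact Nat.card_congr (Equiv.subtypeEquivRight fun w => by rw [ch]; tauto)
    · exact Nat.card_congr (Equiv.subtypeEquivRight fun w => by rw [ch]; tauto)
  have d1 := hs y z hzy hz.2 hz.1 (Or.inl ⟨u, hb.2.2.1, hb.2.1⟩)
  rw [le_min_iff, (c1 y iy).1, (c1 z hz.1).2] at d1
  obtain ⟨w, t, r⟩ := rot2 (w := z) (C := T ++ [z]) (by simp) (st_two h)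
  have hw : w ∈ T ++ [z] := r.mem_iff.2 (by simp)
  have ha := st_alt hirr hs hno h r
  have sw := st_sym hirr hs hno h w hw
  have hwy : A w y := by tauto
  have hn := st_unu hirr hs hno h hw hwy
  have huw : u ≠ w := by rintro rfl; exact st_u h hw
  have d2 := hs u w huw hn.1 hn.2 (Or.inr ⟨y, hb.2.2.1, hwy⟩)
  rw [le_min_iff, (c2 u hb.2.2.1).1, (c2 w hwy).2] at d2
  have e : 2 * Nat.card {v : V // ¬ A v y} = Fintype.card V := by omega
  refine ⟨⟨Nat.card {v : V // ¬ A v y}, by omega⟩, {v | ¬ A v y}, e, fun x x' => ?_⟩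
  rw [ch]; simp
end G2

/-! fourth part -/

theorem ext_full [Fintype V] {l : List V} (h : l.Nodup) : ∃ R, Full (l ++ R) := by
  refine ⟨Finset.univ.toList.filter (fun v => decide (v ∉ l)), ?_, fun v => ?_⟩
  · refine List.nodup_append.2 ⟨h, (Finset.nodup_toList _).filter _, ?_⟩
    rintro a ha b hb rfl
    simp at hb; exact hb ha
  · by_cases hv : v ∈ l <;> simp [hv]

theorem nodup_len [Fintype V] {l : List V} (h : l.Nodup) : l.length ≤ Fintype.card V := by
  obtain ⟨R, hR⟩ := ext_full h
  rw [full_card hR]; simp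

theorem gap_final [Fintype V] (hirr : ∀ v, ¬ A v v) (hs : CondStarStar A) {C : List V} {y p q : V}
    (hC : Cyc A C) (hlen : C.length + 2 ≤ Fintype.card V)
    (hmax : ∀ l, Cyc A l → l.length < Fintype.card V → l.length ≤ C.length)
    (hy : y ∉ C) (hp : p ∈ C) (hq : q ∈ C) (h1 : A p y) (h2 : A y q) :
    Even (Fintype.card V) ∧ IsKhalf A := by
  obtain ⟨E1, E2, hE, hEr⟩ := byp_ex hC hy hp hq h1 h2
  obtain ⟨⟨C1, C2, v⟩, ⟨hB, hBl⟩, hmin⟩ := exists_min (α := List V × List V × V)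
    (fun D => Byp A D.1 D.2.1 D.2.2 ∧ (D.1 ++ D.2.1).length = C.length) (fun D => D.2.1.length)
    ⟨(E1, E2, y), hE, hEr.perm.length_eq.symm⟩
  change Byp A C1 C2 v at hB
  change (C1 ++ C2).length = C.length at hBl
  have hmin' : ∀ D1 D2 w, Byp A D1 D2 w → (D1 ++ D2).length = (C1 ++ C2).length → C2.length ≤ D2.length :=
    fun D1 D2 w hD hl => hmin (D1, D2, w) ⟨hD, hl.trans hBl⟩
  have hno : ∀ l, Cyc A l → l.length ≠ (C1 ++ C2).length + 1 := by
    intro l hl e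
    have := hmax l hl (by omega)
    omega
  have hna : ∀ z ∈ C2, ¬ A z v ∧ ¬ A v z := by
    intro z hz
    by_contra hcon
    obtain ⟨E1, E2, hE, hr, hl⟩ := shrink hB hz (by tauto)
    have := hmin' _ _ _ hE hr.perm.length_eq.symm
    omega
  obtain ⟨hni, hne⟩ := byp_notins hB hno
  obtain ⟨a, t, ha⟩ : ∃ a t, C2 = a :: t := List.exists_cons_of_ne_nil hne
  obtain ⟨t', b, hb⟩ : ∃ t' b, C2 = t' ++ [b] := ⟨_, _, (List.dropLast_append_getLast hne).symm⟩
  obtain ⟨R, hR⟩ := ext_full (l := C1 ++ C2 ++ [v]) (List.nodup_append.2 ⟨hB.2.1.2.1, by simp, by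
    intro x hx z hz; simp at hz; rintro rfl; subst hz; exact hB.2.2.1 hx⟩)
  rw [List.append_assoc (C1 ++ C2), List.singleton_append] at hR
  have hcard := full_card hR
  rw [List.length_append, List.length_cons] at hcard
  by_cases hR2 : 2 ≤ R.length
  · exfalso
    obtain ⟨s1, s2, s3⟩ := step1 hirr hs hB hR hna hno ha hb
    obtain ⟨h1, ⟨c1, c2, c3, c4⟩, h3, h4, h5⟩ := hB
    rw [ch_app] at c3
    rw [Lk_app_left hne, Lk_app_right h1] at c4
    have hnd := hR.1
    by_cases e1 : ∃ u ∈ R, A v u ∧ A u a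
    · obtain ⟨u, hu, vu, ua⟩ := e1
      obtain ⟨r1, r2, rfl⟩ := List.append_of_mem hu
      have : Cyc A (C1 ++ ([v, u] ++ C2)) := by
        refine ⟨by simp, ?_, ?_, ?_⟩
        · rw [nodup_iff'] at *
          intro x; have := hnd x
          simp only [List.count_append, List.count_cons, List.count_nil] at *; omega
        · rw [ch_app, ch_app]
          refine ⟨c3.1, ⟨by simp [vu], c3.2.1, ?_⟩, h4⟩
          rw [Lk_cons_left (by simp), ha]; exact Lk_hd.2 ua
        · rw [← List.append_assoc, Lk_app_left hne, List.append_assoc, Lk_app_right h1]; exact c4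
      have h6 := hmax _ this
      simp only [List.length_append, List.length_cons, List.length_nil] at *
      omega
    by_cases e2 : ∃ u ∈ R, A b u ∧ A u v
    · obtain ⟨u, hu, bu, uv⟩ := e2
      obtain ⟨r1, r2, rfl⟩ := List.append_of_mem hu
      have : Cyc A (C1 ++ (C2 ++ [u, v])) := by
        refine ⟨by simp, ?_, ?_, ?_⟩
        · rw [nodup_iff'] at *
          intro x; have := hnd x
          simp only [List.count_append, List.count_cons, List.count_nil] at *; omega
        · rw [ch_app, ch_app, Lk_app_right hne]
          refine ⟨c3.1, ⟨c3.2.1, by simp [uv], ?_⟩, c3.2.2⟩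
          rw [hb, Lk_app_left (by simp)]; exact Lk_hd.2 bu
        · rw [Lk_app_left (by simp), Lk_app_left (by simp), Lk_cons_left (by simp), Lk_app_right h1]; exact h5
      have h6 := hmax _ this
      simp only [List.length_append, List.length_cons, List.length_nil] at *
      omega
    push Not at e1 e2
    have f1 := cc (A := A) (y := v) (a := a) (R := R) (fun u hu hh => e1 u hu hh.1 hh.2)
    have f2 := cc (A := A) (y := b) (a := v) (R := R) (fun u hu hh => e2 u hu hh.1 hh.2)
    omega
  · have hR1 : R.length = 1 := by omega
    obtain ⟨u, rfl⟩ := List.length_eq_one_iff.1 hR1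
    by_cases hC2 : 2 ≤ C2.length
    · exact (big_gap hirr hs hB hR hmin' hno hC2).elim
    · have ht : t = [] := by
        rw [ha] at hC2; simp at hC2; exact hC2
      subst ht; subst ha
      refine st_final hirr hs ?_ ⟨hB, hR⟩
      intro l hl e
      exact hno l hl (by omega)

theorem pathTo {S : List V} {y c : V} (h : Relation.ReflTransGen A y c) (hc : c ∈ S) (hy : y ∉ S) :
    ∃ P : List V, (y :: P).Nodup ∧ (y :: P).IsChain A ∧ (∀ v ∈ y :: P, v ∉ S) ∧ ∃ c' ∈ S, Lk A (y :: P) [c'] := by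
  induction h using Relation.ReflTransGen.head_induction_on with
  | refl => exact absurd hc hy
  | @head y y1 h1 h2 ih =>
    by_cases hy1 : y1 ∈ S
    · exact ⟨[], by simp, by simp, by simpa using hy, y1, hy1, Lk_single.2 h1⟩
    obtain ⟨P, a1, a2, a3, c', a4, a5⟩ := ih hy1
    by_cases hm : y ∈ y1 :: P
    · obtain ⟨s, t, e⟩ := List.append_of_mem hm
      rw [e] at a1 a2 a3 a5
      refine ⟨t, (List.nodup_append.1 a1).2.1, (ch_app.1 a2).2.1, fun v hv => a3 v (List.mem_append_right _ hv), c', a4, ?_⟩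
      rwa [Lk_app_left (by simp)] at a5
    · refine ⟨y1 :: P, List.nodup_cons.2 ⟨hm, a1⟩, ?_, ?_, c', a4, ?_⟩
      · exact (ch_app (l₁ := [y])).2 ⟨by simp, a2, Lk_hd.2 h1⟩
      · intro v hv
        rcases List.mem_cons.1 hv with rfl | hv
        · exact hy
        · exact a3 v hv
      · rwa [Lk_cons_left (by simp)]

theorem exists_out [Fintype V] (hirr : ∀ v, ¬ A v v) (hs : CondStarStar A) (hst : IsStrong A) {C : List V}
    (hC : Cyc A C) (hlen : C.length + 2 ≤ Fintype.card V) (hm2 : 2 ≤ C.length)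
    (hmax : ∀ l, Cyc A l → l.length < Fintype.card V → l.length ≤ C.length) :
    ∃ y p q, y ∉ C ∧ p ∈ C ∧ q ∈ C ∧ A p y ∧ A y q := by
  by_contra H
  push Not at H
  obtain ⟨c, hc⟩ := List.exists_mem_of_ne_nil _ hC.1
  obtain ⟨v, hv⟩ : ∃ v, v ∉ C := by
    by_contra hcon
    push Not at hcon
    have := full_card (l := C) ⟨hC.2.1, hcon⟩
    omega
  obtain ⟨z, y, hz, hy, hzy⟩ : ∃ z y, z ∈ C ∧ y ∉ C ∧ A z y := by
    by_contra hcon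
    push Not at hcon
    refine hv ?_
    have := hst c v
    induction this with
    | refl => exact hc
    | tail _ h2 ih =>
      by_contra h3
      exact hcon _ _ (by by_contra h4; exact h4 (ih h4)) h3 h2
  have hyo : ∀ q ∈ C, ¬ A y q := fun q hq => H y z q hy hz hq hzy
  have hall : ∀ w ∈ C, A w y := by
    refine around (P := fun w => A w y) ?_ hz hzy
    intro w w' t r hw
    by_contra hw'
    have hcr := cyc_isRot hC r
    have hww : A w w' := by
      have := (ch_app (l₁ := [w]) (l₂ := w' :: t)).1 hcr.2.2.1
      exact Lk_hd.1 this.2.2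
    have hwC : w' ∈ C := r.mem_iff.2 (by simp)
    have r1 : C.IsRotated (w' :: t ++ [w]) := rot1 r
    have hL := cyc_isRot hC r1
    have hLl := r1.perm.length_eq
    obtain ⟨R, hR⟩ := ext_full (l := (w' :: t ++ [w]) ++ [y]) (List.nodup_append.2 ⟨hL.2.1, by simp, by
      intro x hx z hz; simp only [List.mem_singleton] at hz; rintro rfl; subst hz; exact hy (r1.mem_iff.2 hx)⟩)
    rw [List.append_assoc _ [y], List.singleton_append] at hR
    generalize hLe : w' :: t ++ [w] = L at *
    have hcard := full_card hR
    have hwL : w' ∈ L := by rw [← hLe]; simp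
    have hyw : y ≠ w' := by rintro rfl; exact hy hwC
    have d := (dense hs hR hyw (hyo _ hwC) hw' (Or.inl ⟨w, hw, hww⟩)).1
    rw [cout_app, cin_app, cout_cons, cin_cons, if_neg (hirr y), if_neg (hyo _ hwC),
      cout_zero (fun z hz => hyo z (r1.mem_iff.2 hz))] at d
    have k1 := cin_self hirr hwL
    have k2 := cout_le (A := A) (v := y) (l := R)
    have k3 := cin_le (A := A) (v := w') (l := R)
    simp only [List.length_append, List.length_cons] at d hcard
    by_cases hR2 : 2 ≤ R.length
    · have := cc (A := A) (y := y) (a := w') (R := R) (by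
        rintro u hu ⟨yu, uw⟩
        obtain ⟨r3, r2, rfl⟩ := List.append_of_mem hu
        have hnd := hR.1
        have hcy : Cyc A (L ++ [y, u]) := by
          refine ⟨by simp, ?_, ?_, ?_⟩
          · rw [nodup_iff'] at *
            intro x; have := hnd x
            simp only [List.count_append, List.count_cons, List.count_nil] at *; omega
          · rw [ch_app]
            refine ⟨hL.2.2.1, by simp [yu], ?_⟩
            rw [← hLe, Lk_app_left (by simp)]; exact Lk_hd.2 hw
          · rw [Lk_app_left (by simp), Lk_app_right hL.1, Lk_cons_left (by simp), ← hLe]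
            exact Lk_hd.2 uw
        have h6 := hmax _ hcy
        simp only [List.length_append, List.length_cons, List.length_nil] at *
        omega)
      omega
    · omega
  obtain ⟨P, a1, a2, a3, c', a4, a5⟩ := pathTo (hst y c) hc hy
  have hP : P ≠ [] := by
    rintro rfl
    exact hyo c' a4 (Lk_single.1 a5)
  obtain ⟨t, r⟩ := rot_mem a4
  have hle := r.perm.length_eq
  have hcr := cyc_isRot hC r
  have ht : t ≠ [] := by rintro rfl; simp at hle; omega
  obtain ⟨t', b, rfl⟩ : ∃ t' b, t = t' ++ [b] := ⟨_, _, (List.dropLast_append_getLast ht).symm⟩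
  have hnd : (c' :: (t' ++ [b]) ++ y :: P).Nodup := List.nodup_append.2 ⟨hcr.2.1, a1, by
    rintro x hx _ hz rfl; exact a3 x hz (r.mem_iff.2 hx)⟩
  have hnl := nodup_len hnd
  have hcy : Cyc A (c' :: t' ++ y :: P) := by
    refine ⟨by simp, ?_, ?_, ?_⟩
    · rw [nodup_iff'] at *
      intro x; have := hnd x
      simp only [List.count_append, List.count_cons, List.count_nil] at *; omega
    · rw [ch_app]
      refine ⟨(ch_app (l₁ := c' :: t') (l₂ := [b]).1 hcr.2.2.1).1, a2, ?_⟩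
      obtain ⟨x, hx, hx'⟩ := last_ex (A := A) (l := c' :: t') (by simp)
      rw [hx']
      exact Lk_hd.2 (hall x (r.mem_iff.2 (by simp at hx ⊢; tauto)))
    · rw [Lk_app_left (by simp), List.cons_append]
      exact Lk_cons_right.2 a5
  have h6 := hmax _ hcy
  have h7 := List.length_pos_iff.2 hP
  simp only [List.length_append, List.length_cons, List.length_nil] at *
  omega

theorem cyc_fun {k : ℕ} [NeZero k] {l : List V} (h : Cyc A l) (hl : l.length = k) :
    ∃ f : ZMod k → V, Function.Injective f ∧ ∀ i, A (f i) (f (i + 1)) := by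
  have hv : ∀ i : ZMod k, i.val < l.length := fun i => hl ▸ ZMod.val_lt i
  refine ⟨fun i => l[i.val]'(hv i), ?_, ?_⟩
  · intro i j hij
    exact ZMod.val_injective k ((List.Nodup.getElem_inj_iff h.2.1).1 hij)
  · intro i
    have e : (i + 1).val = (i.val + 1) % k := by
      rw [ZMod.val_add, ZMod.val_one_eq_one_mod, Nat.add_mod_mod]
    by_cases hi : i.val + 1 < k
    · rw [Nat.mod_eq_of_lt hi] at e
      have := List.isChain_iff_getElem.1 h.2.2.1 i.val (by omega)
      simpa [e] using this
    · have h1 := ZMod.val_lt i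
      have h2 : i.val + 1 = k := by omega
      rw [h2, Nat.mod_self] at e
      have := h.2.2.2 (l[i.val]'(hv i)) (by
        rw [List.getLast?_eq_getElem?, Option.mem_def, List.getElem?_eq_some_iff]
        refine ⟨by omega, ?_⟩
        congr 1; omega) (l[0]'(by omega)) (by
        rw [List.head?_eq_getElem?, Option.mem_def, List.getElem?_eq_some_iff]
        exact ⟨by omega, rfl⟩)
      simpa [e] using this

theorem short_ex [Fintype V] (hn : 4 ≤ Fintype.card V) (hirr : ∀ v, ¬ A v v) (hst : IsStrong A)
    (hnot : ¬ IsDirectedNCycle A) : ∃ l, Cyc A l ∧ l.length < Fintype.card V := by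
  have h0 : ∃ l, Cyc A l := by
    have : Nontrivial V := Fintype.one_lt_card_iff_nontrivial.1 (by omega)
    obtain ⟨v, v', hvv⟩ := exists_pair_ne V
    obtain ⟨w, hw⟩ : ∃ w, A v w := by
      rcases (hst v v').cases_head with h | ⟨w, h, _⟩
      · exact absurd h hvv
      · exact ⟨w, h⟩
    have hwv : w ≠ v := by rintro rfl; exact hirr _ hw
    obtain ⟨P, a1, a2, a3, c', a4, a5⟩ := pathTo (S := [v]) (hst w v) (by simp) (by simpa using hwv)
    have : c' = v := by simpa using a4
    subst this
    refine ⟨c' :: w :: P, by simp, List.nodup_cons.2 ⟨fun hh => a3 _ hh (by simp), a1⟩, ?_, ?_⟩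
    · exact (ch_app (l₁ := [c'])).2 ⟨by simp, a2, Lk_hd.2 hw⟩
    · rw [Lk_cons_left (by simp)]; exact Lk_cons_right.2 a5
  obtain ⟨L, hL, hmin⟩ := exists_min (Cyc A) List.length h0
  refine ⟨L, hL, lt_of_le_of_ne (nodup_len hL.2.1) fun e => hnot ?_⟩
  have : NeZero (Fintype.card V) := ⟨by omega⟩
  obtain ⟨f, hf, hA⟩ := cyc_fun hL e
  have hb : Function.Bijective f := by
    rw [Fintype.bijective_iff_injective_and_card]
    exact ⟨hf, ZMod.card _⟩
  have hLf : ∀ v, v ∈ L := by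
    obtain ⟨R, hR⟩ := ext_full hL.2.1
    have := full_card hR
    have : R = [] := List.length_eq_zero_iff.1 (by simp at this; omega)
    subst this
    simpa using hR.2
  have uniq : ∀ a b b', A a b → A a b' → b = b' := by
    intro a b b' h1 h2
    obtain ⟨t, r⟩ := rot_mem (hLf a)
    have r1 := rot1 r
    have hc := cyc_isRot hL r1
    have hd : ∀ b, A a b → ∃ w, t ++ [a] = b :: w := by
      intro b hab
      obtain ⟨s, w, e⟩ := List.append_of_mem (r1.mem_iff.1 (hLf b))
      have hcb : Cyc A (b :: w) := by
        have hl : Lk A (t ++ [a]) [b] := (Lk_app_left (by simp)).2 (Lk_single.2 hab)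
        rw [e] at hc hl
        rw [Lk_app_left (by simp)] at hl
        exact ⟨by simp, (List.nodup_append.1 hc.2.1).2.1, (ch_app.1 hc.2.2.1).2.1, Lk_cons_right.2 hl⟩
      have h3 := hmin _ hcb
      have h4 := r1.perm.length_eq
      rw [e, List.length_append] at h4
      have : s = [] := List.length_eq_zero_iff.1 (by omega)
      subst this
      exact ⟨w, e⟩
    obtain ⟨w, e1⟩ := hd b h1
    obtain ⟨w', e2⟩ := hd b' h2
    rw [e1] at e2
    exact (List.cons.inj e2).1
  refine ⟨f, hb, fun a b => ⟨fun hab => ?_, ?_⟩⟩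
  · obtain ⟨i, rfl⟩ := hb.2 a
    exact ⟨i, rfl, uniq _ _ _ hab (hA i)⟩
  · rintro ⟨i, rfl, rfl⟩
    exact hA i

theorem main [Fintype V] (hn : 4 ≤ Fintype.card V) (hirr : ∀ v, ¬ A v v) (hst : IsStrong A)
    (hnot : ¬ IsDirectedNCycle A) (hs : CondStarStar A) :
    HasCycle A (Fintype.card V - 1) ∨ (Even (Fintype.card V) ∧ IsKhalf A) := by
  obtain ⟨C, ⟨hC, hCn⟩, hmin⟩ := exists_min (fun l => Cyc A l ∧ l.length < Fintype.card V)
    (fun l => Fintype.card V - l.length) (short_ex hn hirr hst hnot)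
  have hmax : ∀ l, Cyc A l → l.length < Fintype.card V → l.length ≤ C.length := by
    intro l hl h2
    have : Fintype.card V - C.length ≤ Fintype.card V - l.length := hmin l ⟨hl, h2⟩
    omega
  by_cases h1 : C.length = Fintype.card V - 1
  · left
    have : NeZero (Fintype.card V - 1) := ⟨by omega⟩
    exact cyc_fun hC h1
  · right
    have hlen : C.length + 2 ≤ Fintype.card V := by omega
    have hm2 : 2 ≤ C.length := by
      have h0 := List.length_pos_iff.2 hC.1
      by_contra hcon
      obtain ⟨x, rfl⟩ := List.length_eq_one_iff.1 (show C.length = 1 by omega)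
      exact hirr x (Lk_single.1 hC.2.2.2)
    obtain ⟨y, p, q, hy, hp, hq, hpy, hyq⟩ := exists_out hirr hs hst hC hlen hm2 hmax
    exact gap_final hirr hs hC hlen hmax hy hp hq hpy hyq

end DK

/-- Theorem 2. -/
theorem darbinyan_karapetyan_theorem2 {V : Type*} [Fintype V] (A : V → V → Prop)
    (hn : 4 ≤ Fintype.card V)
    (hirr : ∀ v : V, ¬A v v)
    (hstrong : IsStrong A)
    (hnotcyc : ¬IsDirectedNCycle A)
    (hstarstar : CondStarStar A) :
    HasCycle A (Fintype.card V - 1) ∨ (Even (Fintype.card V) ∧ IsKhalf A) := by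
  exact DK.main hn hirr hstrong hnotcyc hstarstar
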